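/- Let α ∈ (0,1). There exists a constant C > 0 such that for all 0 ≤ s ≤ t: ∫_s^t ∫_s^t (u+v)^{2α−2} du dv ≤ C·(t−s)^{2α}. -/

import Mathlib

open MeasureTheory in
lemma intervalIntegral_mono_of_nonneg {f g : ℝ → ℝ} {a b : ℝ} (hab : a ≤ b)
    (hf : ∀ x ∈ Set.Ioc a b, 0 ≤ f x) (hg : IntervalIntegrable g volume a b)
    (hfg : ∀ x ∈ Set.Ioc a b, f x ≤ g x) :
    ∫ x in a..b, f x ≤ ∫ x in a..b, g x := by
  rw [intervalIntegral.integral_of_le hab, intervalIntegral.integral_of_le hab]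
  exact integral_mono_of_nonneg (ae_restrict_of_forall_mem measurableSet_Ioc hf) hg.1
    (ae_restrict_of_forall_mem measurableSet_Ioc hfg)

lemma add_rpow_le_mul_rpow_sub {α s u v : ℝ} (hα : α ≤ 1) (hs : 0 ≤ s) (hu : s < u)
    (hv : s < v) :
    (u + v) ^ (2 * α - 2) ≤ (u - s) ^ (α - 1) * (v - s) ^ (α - 1) := by
  have hu' : 0 < u - s := sub_pos.2 hu
  have hv' : 0 < v - s := sub_pos.2 hv
  rw [← Real.mul_rpow hu'.le hv'.le, show 2 * α - 2 = 2 * (α - 1) by ring,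
    Real.rpow_mul (by linarith), Real.rpow_two]
  exact Real.rpow_le_rpow_of_nonpos (mul_pos hu' hv') (by nlinarith) (by linarith)

lemma integral_sub_rpow {α : ℝ} (hα : 0 < α) (s t : ℝ) :
    ∫ v in s..t, (v - s) ^ (α - 1) = (t - s) ^ α / α := by
  rw [intervalIntegral.integral_comp_sub_right (fun x : ℝ => x ^ (α - 1)),
    integral_rpow (Or.inl (by linarith))]
  simp [Real.zero_rpow hα.ne']

lemma intervalIntegrable_sub_rpow {α : ℝ} (hα : 0 < α) (s t : ℝ) :
    IntervalIntegrable (fun v : ℝ => (v - s) ^ (α - 1)) MeasureTheory.volume s t := by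
  simpa using (intervalIntegral.intervalIntegrable_rpow' (a := s - s) (b := t - s)
    (show -1 < α - 1 by linarith)).comp_sub_right s

/-- For `α ∈ (0,1)` there is a constant `C > 0` such that for all `0 ≤ s ≤ t`:
`∫_s^t ∫_s^t (u+v)^(2α−2) du dv ≤ C·(t−s)^(2α)`. -/
theorem stmt9 (α : ℝ) (hα : α ∈ Set.Ioo (0 : ℝ) 1) :
    ∃ C : ℝ, 0 < C ∧ ∀ s t : ℝ, 0 ≤ s → s ≤ t →
      ∫ u in s..t, ∫ v in s..t, (u + v) ^ (2 * α - 2) ≤ C * (t - s) ^ (2 * α) := by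
  obtain ⟨h0, h1⟩ := hα
  refine ⟨1 / α ^ 2, by positivity, fun s t hs hst => ?_⟩
  have hnonneg : ∀ u ∈ Set.Ioc s t, ∀ v ∈ Set.Ioc s t, 0 ≤ (u + v) ^ (2 * α - 2) :=
    fun u hu v hv => Real.rpow_nonneg (by linarith [hu.1, hv.1]) _
  calc ∫ u in s..t, ∫ v in s..t, (u + v) ^ (2 * α - 2)
      ≤ ∫ u in s..t, (u - s) ^ (α - 1) * ((t - s) ^ α / α) := by
        refine intervalIntegral_mono_of_nonneg hst (fun u hu => ?_)
          ((intervalIntegrable_sub_rpow h0 s t).mul_const _) (fun u hu => ?_)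
        · rw [intervalIntegral.integral_of_le hst]
          exact MeasureTheory.setIntegral_nonneg measurableSet_Ioc (hnonneg u hu)
        · rw [← integral_sub_rpow h0, ← intervalIntegral.integral_const_mul]
          exact intervalIntegral_mono_of_nonneg hst (hnonneg u hu)
            ((intervalIntegrable_sub_rpow h0 s t).const_mul _)
            fun v hv => add_rpow_le_mul_rpow_sub h1.le hs hu.1 hv.1
    _ = 1 / α ^ 2 * (t - s) ^ (2 * α) := by
        rw [intervalIntegral.integral_mul_const, integral_sub_rpow h0, mul_comm 2 α,
          Real.rpow_mul (sub_nonneg.2 hst), Real.rpow_two]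
        ring
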